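/- Let L be a lattice of rank n, let (v_1,…,v_n) be a Minkowski-reduced basis of L, let 3 ≤ k < n, and let w_1,…,w_k ∈ L be linearly independent vectors with ‖w_i‖ = λ_i(L) for each i. If span_ℤ(v_1,…,v_k) = span_ℤ(w_1,…,w_k), then ‖v_{k+1}‖² ≤ ((k+1)/4)·λ_{k+1}(L)². -/

import Mathlib

open scoped BigOperators
noncomputable section

/-- Euclidean space ℝ^m. -/
abbrev E (m : ℕ) := EuclideanSpace ℝ (Fin m)

/-- `L` is a lattice of rank `n` in `ℝ^m`: a discrete additive subgroup spanning an
`n`-dimensional real subspace. -/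
def IsLattice {m : ℕ} (L : AddSubgroup (E m)) (n : ℕ) : Prop :=
  DiscreteTopology L ∧ Module.finrank ℝ (Submodule.span ℝ (L : Set (E m))) = n

/-- `b` is a basis of the lattice `L`: a tuple of vectors of `L` generating `L`
as a ℤ-module. -/
def IsLatticeBasis {m n : ℕ} (L : AddSubgroup (E m)) (b : Fin n → E m) : Prop :=
  (∀ i, b i ∈ L) ∧ (Submodule.span ℤ (Set.range b) : Set (E m)) = (L : Set (E m))

/-- `b` is a primitive tuple of vectors of `L`: it is linearly independent and
`span_ℤ(b) = span_ℝ(b) ∩ L`; equivalently, it can be extended to a basis of `L`. -/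
def IsPrimitiveTuple {m k : ℕ} (L : AddSubgroup (E m)) (b : Fin k → E m) : Prop :=
  (∀ i, b i ∈ L) ∧ LinearIndependent ℝ b ∧
  (Submodule.span ℤ (Set.range b) : Set (E m)) =
    (Submodule.span ℝ (Set.range b) : Set (E m)) ∩ (L : Set (E m))

/-- The first `i` entries of the tuple `v`. -/
def truncTuple {m n : ℕ} (v : Fin n → E m) (i : Fin n) : Fin i → E m :=
  fun j => v (Fin.castLE i.isLt.le j)

/-- `v` is a Minkowski-reduced basis of `L`: it is a basis and, for each `i`, `v i` has
minimal norm among all `w ∈ L` such that `(v 0, …, v (i-1), w)` is primitive. -/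
def IsMinkowskiReduced {m n : ℕ} (L : AddSubgroup (E m)) (v : Fin n → E m) : Prop :=
  IsLatticeBasis L v ∧ ∀ i : Fin n, ∀ w ∈ L,
    IsPrimitiveTuple L (Fin.snoc (truncTuple v i) w) → ‖v i‖ ≤ ‖w‖

/-- The `i`-th successive minimum `λ_i(L)`: the least `r ≥ 0` such that `L` contains
`i` linearly independent vectors of norm at most `r`. -/
def succMin {m : ℕ} (L : AddSubgroup (E m)) (i : ℕ) : ℝ :=
  sInf {r : ℝ | 0 ≤ r ∧ ∃ v : Fin i → E m,
    (∀ j, v j ∈ L) ∧ LinearIndependent ℝ v ∧ ∀ j, ‖v j‖ ≤ r}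

/-- Every vector `∑ i, a i • w i` can be rounded to an integer combination of the `w i` so that the
squared norms of the rounding errors add up, each coordinate contributing at most `‖w i‖² / 4`. -/
lemma exists_int_norm_add_sum_sq_le {F : Type*} [NormedAddCommGroup F] [InnerProductSpace ℝ F]
    {ι : Type*} (s : Finset ι) (w : ι → F) (a : ι → ℝ) (z : F) :
    ∃ c : ι → ℤ, ‖z + ∑ i ∈ s, (a i - c i) • w i‖ ^ 2 ≤ ‖z‖ ^ 2 + ∑ i ∈ s, ‖w i‖ ^ 2 / 4 := by
  classical
  induction s using Finset.induction_on with
  | empty => exact ⟨0, by simp⟩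
  | insert i s hi ih =>
    obtain ⟨c, hc⟩ := ih
    set y := z + ∑ i ∈ s, (a i - c i) • w i
    have key : ∃ e : ℤ, ‖y + (a i - e) • w i‖ ^ 2 ≤ ‖y‖ ^ 2 + ‖w i‖ ^ 2 / 4 := by
      have expand (e : ℤ) : ‖y + (a i - e) • w i‖ ^ 2 =
          ‖y‖ ^ 2 + 2 * ((a i - e) * inner ℝ y (w i)) + (a i - e) ^ 2 * ‖w i‖ ^ 2 := by
        rw [norm_add_sq_real, inner_smul_right, norm_smul, mul_pow, Real.norm_eq_abs, sq_abs]
      by_contra! h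
      have h0 := h ⌊a i⌋
      have h1 := h (⌊a i⌋ + 1)
      rw [expand] at h0 h1
      push_cast at h1
      have hp0 : 0 ≤ a i - ⌊a i⌋ := sub_nonneg.2 (Int.floor_le _)
      have hp1 : a i - ⌊a i⌋ < 1 := by linarith [Int.lt_floor_add_one (a i)]
      have hrw : a i - (⌊a i⌋ + 1 : ℝ) = (a i - ⌊a i⌋) - 1 := by ring
      rw [hrw] at h1
      generalize a i - (⌊a i⌋ : ℝ) = p at *
      generalize inner ℝ y (w i) = q at *
      have hw : 0 ≤ ‖w i‖ ^ 2 := by positivity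
      generalize ‖w i‖ ^ 2 = W at *
      have e0 := mul_lt_mul_of_pos_left h0 (sub_pos.2 hp1)
      have e1 := mul_le_mul_of_nonneg_left h1.le hp0
      nlinarith [mul_nonneg hw (sq_nonneg (2 * p - 1))]
    obtain ⟨e, he⟩ := key
    refine ⟨Function.update c i e, ?_⟩
    have hs : ∑ j ∈ s, (a j - (Function.update c i e j : ℤ)) • w j
        = ∑ j ∈ s, (a j - c j) • w j := by
      refine Finset.sum_congr rfl fun j hj => ?_
      rw [Function.update_of_ne (ne_of_mem_of_not_mem hj hi)]
    rw [Finset.sum_insert hi, Finset.sum_insert hi, hs, Function.update_self, add_left_comm,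
      add_comm _ (z + _)]
    linarith

/-- A basis of a rank `n` lattice by `n` vectors is linearly independent over `ℝ`. -/
lemma IsLatticeBasis.linearIndependent {m n : ℕ} {L : AddSubgroup (E m)} {v : Fin n → E m}
    (hv : IsLatticeBasis L v) (hL : IsLattice L n) : LinearIndependent ℝ v := by
  rw [linearIndependent_iff_card_eq_finrank_span, Fintype.card_fin, Set.finrank]
  rw [← Submodule.span_span_of_tower ℤ ℝ, hv.2, hL.2]

/-- A lattice vector in the real span of the first basis vectors is an integer combination
of them. -/
lemma IsLatticeBasis.mem_span_truncTuple {m n : ℕ} {L : AddSubgroup (E m)} {v : Fin n → E m}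
    (hv : IsLatticeBasis L v) (hli : LinearIndependent ℝ v) (i : Fin n) {x : E m} (hxL : x ∈ L)
    (hx : x ∈ Submodule.span ℝ (Set.range (truncTuple v i))) :
    x ∈ Submodule.span ℤ (Set.range (truncTuple v i)) := by
  have hxZ : x ∈ Submodule.span ℤ (Set.range v) := by
    rw [← SetLike.mem_coe, hv.2]; exact hxL
  obtain ⟨c, rfl⟩ := (Submodule.mem_span_range_iff_exists_fun ℤ).1 hxZ
  refine Submodule.sum_mem _ fun j _ => ?_
  by_cases hj : j < i
  · exact Submodule.smul_mem _ _ (Submodule.subset_span ⟨⟨j, hj⟩, rfl⟩)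
  · suffices c j = 0 by simp [this]
    obtain ⟨g, hg⟩ := LinearMap.exists_leftInverse_of_injective (Fintype.linearCombination ℝ v)
      (LinearMap.ker_eq_bot.2 hli.fintypeLinearCombination_injective)
    have hgv (l : Fin n) : g (v l) = Pi.single l 1 := by
      simpa using LinearMap.congr_fun hg (Pi.single l 1)
    have hzero : ∀ y ∈ Submodule.span ℝ (Set.range (truncTuple v i)), g y j = 0 := by
      intro y hy
      induction hy using Submodule.span_induction with
      | mem y hy =>
        obtain ⟨l, rfl⟩ := hy
        rw [truncTuple, hgv, Pi.single_eq_of_ne]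
        rintro rfl
        exact hj l.isLt
      | zero => simp
      | add y z _ _ hy hz => simp [hy, hz]
      | smul a y _ hy => simp [hy]
    have := hzero _ hx
    simpa [hgv, ← Int.cast_smul_eq_zsmul ℝ, Finset.sum_apply, Pi.single_apply] using this

/-- A functional that is integral on the lattice, vanishes on the first basis vectors and takes the
value `1` at `t` certifies that `t` extends these vectors to a primitive tuple. -/
lemma IsLatticeBasis.isPrimitiveTuple_snoc {m n : ℕ} {L : AddSubgroup (E m)} {v : Fin n → E m}
    (hv : IsLatticeBasis L v) (hli : LinearIndependent ℝ v) (i : Fin n) {t : E m} (ht : t ∈ L)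
    (φ : E m →ₗ[ℝ] ℝ) (hφL : ∀ x ∈ L, ∃ z : ℤ, φ x = z) (hφv : ∀ j, φ (truncTuple v i j) = 0)
    (hφt : φ t = 1) : IsPrimitiveTuple L (Fin.snoc (truncTuple v i) t) := by
  have hφV : ∀ y ∈ Submodule.span ℝ (Set.range (truncTuple v i)), φ y = 0 := by
    intro y hy
    have : Submodule.span ℝ (Set.range (truncTuple v i)) ≤ LinearMap.ker φ := by
      rw [Submodule.span_le]; rintro _ ⟨j, rfl⟩; exact hφv j
    exact this hy
  have hmem : ∀ j, (Fin.snoc (truncTuple v i) t : Fin (i + 1) → E m) j ∈ L := by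
    intro j
    refine Fin.lastCases ?_ (fun j => ?_) j
    · simpa using ht
    · simpa using! hv.1 _
  have hrange : Set.range (Fin.snoc (truncTuple v i) t : Fin (i + 1) → E m)
      = insert t (Set.range (truncTuple v i)) := Fin.range_snoc _ _
  refine ⟨hmem, ?_, ?_⟩
  · refine linearIndependent_finSnoc.2 ⟨hli.comp _ (Fin.castLE_injective i.isLt.le), fun h => ?_⟩
    simp [hφV t h] at hφt
  · ext x
    constructor
    · intro hx
      refine ⟨Submodule.span_subset_span ℤ ℝ _ hx, ?_⟩
      have : Submodule.span ℤ (Set.range (Fin.snoc (truncTuple v i) t : Fin (i + 1) → E m))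
          ≤ AddSubgroup.toIntSubmodule L := by
        rw [Submodule.span_le]; rintro _ ⟨j, rfl⟩; exact hmem j
      exact this hx
    · rintro ⟨hx, hxL⟩
      rw [SetLike.mem_coe, hrange] at hx ⊢
      obtain ⟨s, y, hy, rfl⟩ := Submodule.mem_span_insert.1 hx
      obtain ⟨z, hz⟩ := hφL _ hxL
      obtain rfl : s = z := by simpa [hφV y hy, hφt] using hz
      rw [Int.cast_smul_eq_zsmul] at hxL ⊢
      refine Submodule.mem_span_insert.2 ⟨z, y, ?_, rfl⟩
      refine hv.mem_span_truncTuple hli i ?_ hy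
      simpa using L.sub_mem hxL (L.zsmul_mem ht z)

/-- A lattice vector `u` outside the real span `V` of the first basis vectors is, modulo `V`,
a positive multiple of a lattice vector that extends them to a primitive tuple. -/
lemma IsLatticeBasis.exists_functional {m n : ℕ} {L : AddSubgroup (E m)} {v : Fin n → E m}
    (hv : IsLatticeBasis L v) (hli : LinearIndependent ℝ v) (i : Fin n) {u : E m} (hu : u ∈ L)
    (huV : u ∉ Submodule.span ℝ (Set.range (truncTuple v i))) :
    ∃ (φ : E m →ₗ[ℝ] ℝ) (d : ℕ) (t : E m), (∀ x ∈ L, ∃ z : ℤ, φ x = z) ∧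
      (∀ j, φ (truncTuple v i j) = 0) ∧ 0 < d ∧ t ∈ L ∧ φ t = 1 ∧ φ u = d ∧
      u - (d : ℝ) • t ∈ Submodule.span ℝ (Set.range (truncTuple v i)) := by
  obtain ⟨g, hg⟩ := LinearMap.exists_leftInverse_of_injective (Fintype.linearCombination ℝ v)
    (LinearMap.ker_eq_bot.2 hli.fintypeLinearCombination_injective)
  have hgv (l : Fin n) : g (v l) = Pi.single l 1 := by
    simpa using LinearMap.congr_fun hg (Pi.single l 1)
  have hgs (c : Fin n → ℤ) (j : Fin n) : g (∑ l, c l • v l) j = c j := by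
    simp [hgv, ← Int.cast_smul_eq_zsmul ℝ, Finset.sum_apply, Pi.single_apply]
  have hcoord : ∀ x ∈ L, ∃ c : Fin n → ℤ, ∑ l, c l • v l = x := by
    intro x hx
    refine (Submodule.mem_span_range_iff_exists_fun ℤ).1 ?_
    rw [← SetLike.mem_coe, hv.2]; exact hx
  obtain ⟨c, hc⟩ := hcoord u hu
  let c' : Fin n → ℤ := fun j => if j < i then 0 else c j
  let I : Ideal ℤ := Ideal.span (Set.range c')
  obtain ⟨d, hd⟩ : ∃ d : ℕ, I = Ideal.span {(d : ℤ)} := by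
    refine ⟨(Submodule.IsPrincipal.generator I).natAbs, ?_⟩
    rw [Int.span_natAbs, Ideal.span_singleton_generator]
  obtain ⟨b, hb⟩ : ∃ b : Fin n → ℤ, ∑ j, b j * c' j = d :=
    Ideal.mem_span_range_iff_exists_fun.1 (hd.ge (Ideal.mem_span_singleton_self (d : ℤ)))
  have hdvd (j : Fin n) : ∃ e : ℤ, c' j = d * e := by
    refine Ideal.mem_span_singleton.1 ?_
    rw [← hd]
    exact Ideal.subset_span ⟨j, rfl⟩
  choose e he using hdvd
  have hsub : u - ∑ j, c' j • v j ∈ Submodule.span ℝ (Set.range (truncTuple v i)) := by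
    rw [← hc, ← Finset.sum_sub_distrib]
    refine Submodule.sum_mem _ fun j _ => ?_
    by_cases hj : j < i
    · simp only [c', hj, if_true, zero_smul, sub_zero]
      exact zsmul_mem (Submodule.subset_span (Set.mem_range_self (⟨j, hj⟩ : Fin i))) _
    · simp [c', hj]
  have hd0 : 0 < d := by
    refine Nat.pos_of_ne_zero fun h => huV ?_
    simpa [he, h] using hsub
  let φ : E m →ₗ[ℝ] ℝ := ∑ j, (if j < i then 0 else (b j : ℝ)) • (LinearMap.proj j ∘ₗ g)
  have hφ (x : E m) : φ x = ∑ j, (if j < i then 0 else (b j : ℝ)) * g x j := by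
    simp only [φ, LinearMap.sum_apply, LinearMap.smul_apply, LinearMap.comp_apply,
      LinearMap.proj_apply, smul_eq_mul]
  have hφs (a : Fin n → ℤ) : φ (∑ l, a l • v l) = (∑ j, if j < i then 0 else b j * a j : ℤ) := by
    rw [hφ]
    push_cast
    refine Finset.sum_congr rfl fun j _ => ?_
    rw [hgs]
    split_ifs <;> simp
  have hφu : φ u = d := by
    rw [← hc, hφs]
    have : (∑ j, if j < i then 0 else b j * c j) = (d : ℤ) := by
      rw [← hb]
      refine Finset.sum_congr rfl fun j _ => ?_
      by_cases hj : j < i <;> simp [c', hj]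
    rw [this, Int.cast_natCast]
  have hφv (j) : φ (truncTuple v i j) = 0 := by
    rw [hφ, truncTuple, hgv]
    refine Finset.sum_eq_zero fun l _ => ?_
    by_cases hl : l < i
    · simp [hl]
    · rw [Pi.single_eq_of_ne, mul_zero]
      rintro rfl
      exact hl j.isLt
  have hut : u - (d : ℝ) • ∑ j, e j • v j ∈ Submodule.span ℝ (Set.range (truncTuple v i)) := by
    convert hsub using 2
    rw [Finset.smul_sum]
    refine Finset.sum_congr rfl fun j _ => ?_
    rw [he, mul_smul, ← Int.cast_smul_eq_zsmul ℝ (d : ℤ), Int.cast_natCast]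
  refine ⟨φ, d, ∑ j, e j • v j, ?_, hφv, hd0,
    L.sum_mem fun j _ => L.zsmul_mem (hv.1 j) _, ?_, hφu, hut⟩
  · intro x hx
    obtain ⟨a, rfl⟩ := hcoord x hx
    exact ⟨_, hφs a⟩
  · have hker : Submodule.span ℝ (Set.range (truncTuple v i)) ≤ LinearMap.ker φ := by
      rw [Submodule.span_le]; rintro _ ⟨j, rfl⟩; exact hφv j
    have h0 : φ (u - (d : ℝ) • ∑ j, e j • v j) = 0 := hker hut
    rw [map_sub, map_smul, hφu, smul_eq_mul, sub_eq_zero] at h0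
    have hdR : (d : ℝ) ≠ 0 := by exact_mod_cast hd0.ne'
    exact mul_left_cancel₀ hdR (by rw [← h0, mul_one])

/-- Let `L` be a lattice of rank `n`, `v` a Minkowski-reduced basis of `L`,
`3 ≤ k < n`, and `w_1, …, w_k ∈ L` linearly independent with `‖w_i‖ = λ_i(L)`. If
`span_ℤ(v_1, …, v_k) = span_ℤ(w_1, …, w_k)`, then `‖v_{k+1}‖² ≤ ((k+1)/4)·λ_{k+1}(L)²`. -/
theorem minkowski_next_bound_of_span_eq {m n : ℕ} (L : AddSubgroup (E m))
    (hL : IsLattice L n) (v : Fin n → E m) (hv : IsMinkowskiReduced L v)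
    (k : ℕ) (hk3 : 3 ≤ k) (hkn : k < n)
    (w : Fin k → E m) (hw : ∀ i, w i ∈ L) (hind : LinearIndependent ℝ w)
    (hlen : ∀ i : Fin k, ‖w i‖ = succMin L ((i : ℕ) + 1))
    (hspan : Submodule.span ℤ (Set.range (fun j : Fin k => v (Fin.castLE hkn.le j))) =
      Submodule.span ℤ (Set.range w)) :
    ‖v ⟨k, hkn⟩‖ ^ 2 ≤ (((k : ℝ) + 1) / 4) * (succMin L (k + 1)) ^ 2 := by
  have hb := hv.1
  have hli := hb.linearIndependent hL
  set i : Fin n := ⟨k, hkn⟩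
  change Submodule.span ℤ (Set.range (truncTuple v i)) = _ at hspan
  have hspanR : Submodule.span ℝ (Set.range (truncTuple v i))
      = Submodule.span ℝ (Set.range w) := by
    rw [← Submodule.span_span_of_tower ℤ ℝ, hspan, Submodule.span_span_of_tower]
  have hne : {r : ℝ | 0 ≤ r ∧ ∃ v : Fin (k + 1) → E m,
      (∀ j, v j ∈ L) ∧ LinearIndependent ℝ v ∧ ∀ j, ‖v j‖ ≤ r}.Nonempty :=
    ⟨∑ j, ‖v j‖, by positivity, fun j => v (Fin.castLE hkn j), fun j => hb.1 _,
      hli.comp _ (Fin.castLE_injective hkn),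
      fun j => Finset.single_le_sum (f := fun j => ‖v j‖) (fun _ _ => norm_nonneg _)
        (Finset.mem_univ (Fin.castLE hkn j))⟩
  have hk3' : (3 : ℝ) ≤ k := by exact_mod_cast hk3
  have hC : 0 < ((k : ℝ) + 1) / 4 := by positivity
  suffices h : ∀ r : ℝ, 0 ≤ r → (∃ y : Fin (k + 1) → E m,
      (∀ j, y j ∈ L) ∧ LinearIndependent ℝ y ∧ ∀ j, ‖y j‖ ≤ r) →
      ‖v i‖ ^ 2 ≤ (((k : ℝ) + 1) / 4) * r ^ 2 by
    have hS : 0 < √(((k : ℝ) + 1) / 4) := Real.sqrt_pos.2 hC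
    have hle : ‖v i‖ / √(((k : ℝ) + 1) / 4) ≤ succMin L (k + 1) := by
      refine le_csInf hne ?_
      rintro r ⟨hr, hy⟩
      rw [div_le_iff₀ hS]
      refine le_of_sq_le_sq ?_ (by positivity)
      rw [mul_pow, Real.sq_sqrt hC.le, mul_comm]
      exact h r hr hy
    rw [div_le_iff₀ hS] at hle
    calc ‖v i‖ ^ 2 ≤ (succMin L (k + 1) * √(((k : ℝ) + 1) / 4)) ^ 2 := by gcongr
      _ = _ := by rw [mul_pow, Real.sq_sqrt hC.le, mul_comm]
  rintro r hr ⟨y, hyL, hyli, hyr⟩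
  have hwr (l : Fin k) : ‖w l‖ ≤ r := by
    rw [hlen]
    have hl : (l : ℕ) + 1 ≤ k + 1 := by omega
    exact csInf_le ⟨0, fun _ h => h.1⟩ ⟨hr, fun j => y (Fin.castLE hl j), fun j => hyL _,
      hyli.comp _ (Fin.castLE_injective hl), fun j => hyr _⟩
  obtain ⟨j, hj⟩ : ∃ j, y j ∉ Submodule.span ℝ (Set.range (truncTuple v i)) := by
    by_contra! hall
    have hsub : Submodule.span ℝ (Set.range y)
        ≤ Submodule.span ℝ (Set.range (truncTuple v i)) := by
      rw [Submodule.span_le]; rintro _ ⟨j, rfl⟩; exact hall j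
    have h1 := Submodule.finrank_mono hsub
    rw [finrank_span_eq_card hyli, hspanR, finrank_span_eq_card hind] at h1
    simp at h1
  obtain ⟨φ, d, t, hφL, hφv, hd, ht, hφt, hφu, hut⟩ := hb.exists_functional hli i (hyL j) hj
  obtain rfl | hd2 : d = 1 ∨ 2 ≤ d := by omega
  · have := hv.2 i _ (hyL j)
      (hb.isPrimitiveTuple_snoc hli i (hyL j) φ hφL hφv (by simpa using hφu))
    calc ‖v i‖ ^ 2 ≤ r ^ 2 := by gcongr; exact this.trans (hyr j)
      _ ≤ _ := by nlinarith [sq_nonneg r]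
  · have hd2' : (2 : ℝ) ≤ d := by exact_mod_cast hd2
    have hd0 : (d : ℝ) ≠ 0 := by positivity
    rw [hspanR] at hut
    obtain ⟨a, ha⟩ := (Submodule.mem_span_range_iff_exists_fun ℝ).1 hut
    obtain ⟨c, hc⟩ := exists_int_norm_add_sum_sq_le Finset.univ w (fun l => -(a l / d))
      ((d : ℝ)⁻¹ • y j)
    have heq : (d : ℝ)⁻¹ • y j + ∑ l, (-(a l / d) - c l) • w l = t - ∑ l, c l • w l := by
      have h1 : ∑ l, (-(a l / d) - c l) • w l = -((d : ℝ)⁻¹ • ∑ l, a l • w l) - ∑ l, c l • w l := by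
        rw [Finset.smul_sum, ← Finset.sum_neg_distrib, ← Finset.sum_sub_distrib]
        refine Finset.sum_congr rfl fun l _ => ?_
        rw [sub_smul, neg_smul, smul_smul, div_eq_inv_mul, Int.cast_smul_eq_zsmul]
      rw [h1, ha, smul_sub, smul_smul, inv_mul_cancel₀ hd0, one_smul]
      abel
    rw [heq] at hc
    have hcL : t - ∑ l, c l • w l ∈ L :=
      L.sub_mem ht (L.sum_mem fun l _ => L.zsmul_mem (hw l) _)
    have hφw : φ (∑ l, c l • w l) = 0 := by
      have hker : Submodule.span ℝ (Set.range (truncTuple v i)) ≤ LinearMap.ker φ := by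
        rw [Submodule.span_le]; rintro _ ⟨j, rfl⟩; exact hφv j
      refine hker ?_
      rw [hspanR]
      exact Submodule.sum_mem _ fun l _ => zsmul_mem (Submodule.subset_span (Set.mem_range_self l)) _
    have hmin := hv.2 i _ hcL
      (hb.isPrimitiveTuple_snoc hli i hcL φ hφL hφv (by rw [map_sub, hφt, hφw, sub_zero]))
    have hu : ‖(d : ℝ)⁻¹ • y j‖ ≤ r / 2 := by
      rw [norm_smul, norm_inv, Real.norm_natCast, inv_mul_eq_div]
      exact div_le_div₀ hr (hyr j) two_pos hd2'
    calc ‖v i‖ ^ 2 ≤ ‖t - ∑ l, c l • w l‖ ^ 2 := by gcongr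
      _ ≤ ‖(d : ℝ)⁻¹ • y j‖ ^ 2 + ∑ l, ‖w l‖ ^ 2 / 4 := hc
      _ ≤ (r / 2) ^ 2 + ∑ _l : Fin k, r ^ 2 / 4 := by gcongr with l; exact hwr l
      _ = _ := by simp; ring
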